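/- Let p > 3 be a prime and let a be a rational number whose denominator is coprime to p. Then Σ_{k=0}^{p-1} binom(p-1,k)·C(-a,k)·C(a-1,k)·(-1)^k ≡ (-1)^{⟨-a⟩_p} · (1 + 2p·(B_{p-1}(a) − B_{p-1})) (mod p²), where binom(p-1,k) is the ordinary binomial coefficient. -/

import Mathlib

open Finset

/-- Generalized binomial coefficient `C(a,k) = a(a-1)⋯(a-k+1)/k!` for a rational `a`. -/
noncomputable def gchoose (a : ℚ) (k : ℕ) : ℚ :=
  (∏ j ∈ Finset.range k, (a - j)) / (Nat.factorial k : ℚ)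

/-- The harmonic number `H_k = ∑_{j=1}^k 1/j`. -/
def harm (k : ℕ) : ℚ := ∑ j ∈ Finset.range k, (1 : ℚ) / (j + 1)

/-- The second-order harmonic number `H_k^{(2)} = ∑_{j=1}^k 1/j²`. -/
def harm2 (k : ℕ) : ℚ := ∑ j ∈ Finset.range k, (1 : ℚ) / (j + 1) ^ 2

/-- `x ≡ y (mod p^m)` for rationals: the p-adic valuation of `x - y` is at least `m`
(with the convention that the valuation of `0` is `+∞`). -/
def CongrMod (p m : ℕ) (x y : ℚ) : Prop :=
  x = y ∨ (m : ℤ) ≤ padicValRat p (x - y)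

/-- The Bernoulli polynomial `B_n` evaluated at a rational `x`. -/
noncomputable def bpoly (n : ℕ) (x : ℚ) : ℚ := (Polynomial.bernoulli n).eval x

/-- The Euler polynomial `E_n` evaluated at a rational `x`, via
`E_n(x) = (2/(n+1))·(B_{n+1}(x) − 2^{n+1}·B_{n+1}(x/2))`. -/
noncomputable def epoly (n : ℕ) (x : ℚ) : ℚ :=
  (2 / (n + 1 : ℚ)) * (bpoly (n + 1) x - 2 ^ (n + 1) * bpoly (n + 1) (x / 2))

/-- The Euler number `E_n = 2^n · E_n(1/2)`. -/
noncomputable def eulerNum (n : ℕ) : ℚ := 2 ^ n * epoly n (1 / 2)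

theorem gchoose_zero (a : ℚ) : gchoose a 0 = 1 := by simp [gchoose]

theorem gchoose_succ (a : ℚ) (k : ℕ) :
    gchoose a (k + 1) = gchoose a k * (a - k) / (k + 1) := by
  have h : (k.factorial : ℚ) ≠ 0 := by exact_mod_cast k.factorial_ne_zero
  have h' : (k + 1 : ℚ) ≠ 0 := by positivity
  simp only [gchoose, prod_range_succ, Nat.factorial_succ]
  push_cast
  field_simp

theorem gchoose_succ_eq_mul_pred (a : ℚ) (k : ℕ) :
    gchoose a (k + 1) = a / (k + 1) * gchoose (a - 1) k := by
  induction k with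
  | zero => simp [gchoose]
  | succ k ih =>
    have h' : (k + 1 : ℚ) ≠ 0 := by positivity
    have h'' : (k + 1 + 1 : ℚ) ≠ 0 := by positivity
    rw [gchoose_succ a (k + 1), ih, gchoose_succ (a - 1) k]
    push_cast
    field_simp
    ring

theorem gchoose_neg_one (k : ℕ) : gchoose (-1) k = (-1) ^ k := by
  induction k with
  | zero => simp [gchoose_zero]
  | succ k ih =>
    have h' : (k + 1 : ℚ) ≠ 0 := by positivity
    rw [gchoose_succ, ih, pow_succ]
    field_simp
    ring

theorem gchoose_natCast_eq_zero {t k : ℕ} (h : t < k) : gchoose t k = 0 := by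
  simp only [gchoose]
  rw [prod_eq_zero (mem_range.2 h) (sub_self _), zero_div]

theorem harm_succ (k : ℕ) : harm (k + 1) = harm k + 1 / (k + 1) := by
  simp [harm, sum_range_succ]

/-- The summand `C(x,k) C(-1-x,k)`. -/
noncomputable def gchooseProd (x : ℚ) (k : ℕ) : ℚ := gchoose x k * gchoose (-1 - x) k

theorem gchooseProd_zero (x : ℚ) : gchooseProd x 0 = 1 := by simp [gchooseProd, gchoose_zero]

theorem gchooseProd_succ_add_pred (x : ℚ) (n : ℕ) :
    gchooseProd x (n + 1) + gchooseProd (x - 1) (n + 1) =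
      2 * (gchoose (x - 1) (n + 1) * gchoose (-1 - x) (n + 1)) -
        2 * (gchoose (x - 1) n * gchoose (-1 - x) n) := by
  have h' : (n + 1 : ℚ) ≠ 0 := by positivity
  have e : -1 - (x - 1) = -x := by ring
  have e' : -x - 1 = -1 - x := by ring
  simp only [gchooseProd, e]
  rw [gchoose_succ_eq_mul_pred x, gchoose_succ_eq_mul_pred (-x), e', gchoose_succ (x - 1),
    gchoose_succ (-1 - x)]
  field_simp
  ring

theorem sum_gchooseProd_add_pred (x : ℚ) (n : ℕ) :
    ∑ k ∈ range (n + 1), (gchooseProd x k + gchooseProd (x - 1) k) =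
      2 * (gchoose (x - 1) n * gchoose (-1 - x) n) := by
  induction n with
  | zero => simp [gchooseProd, gchoose_zero]; norm_num
  | succ n ih =>
    rw [sum_range_succ, ih, gchooseProd_succ_add_pred]
    ring

theorem mul_sum_gchooseProd_harm_add_pred (x : ℚ) (n : ℕ) :
    x * ∑ k ∈ range (n + 1), (gchooseProd x k + gchooseProd (x - 1) k) * harm k =
      2 * x * (gchoose (x - 1) n * gchoose (-1 - x) n) * harm n -
        2 * ∑ k ∈ range n, gchoose x (k + 1) * gchoose (-1 - x) k := by
  induction n with
  | zero => simp [harm]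
  | succ n ih =>
    have h' : (n + 1 : ℚ) ≠ 0 := by positivity
    rw [sum_range_succ, mul_add, ih, gchooseProd_succ_add_pred, harm_succ,
      sum_range_succ _ n, gchoose_succ_eq_mul_pred x n]
    field_simp
    ring

theorem sum_gchoose_succ_mul_add (x : ℚ) (n : ℕ) :
    ∑ k ∈ range (n + 1), (gchoose x (k + 1) * gchoose (-1 - x) k +
        gchoose (x + 1) (k + 1) * gchoose (-1 - (x + 1)) k) =
      (2 * x + 1) / (n + 1) * (gchoose (x - 1) n * gchoose (-1 - (x + 1)) n) := by
  induction n with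
  | zero => simp [gchoose_zero, gchoose_succ]; ring
  | succ n ih =>
    have h' : (n + 1 : ℚ) ≠ 0 := by positivity
    have h'' : (n + 1 + 1 : ℚ) ≠ 0 := by positivity
    have e : -1 - x - 1 = -1 - (x + 1) := by ring
    have e' : x + 1 - 1 = x := by ring
    rw [sum_range_succ, ih, gchoose_succ_eq_mul_pred x (n + 1),
      gchoose_succ_eq_mul_pred (x + 1) (n + 1), e', gchoose_succ_eq_mul_pred x n,
      gchoose_succ_eq_mul_pred (-1 - x) n, e, gchoose_succ (x - 1), gchoose_succ (-1 - (x + 1))]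
    push_cast
    field_simp
    ring

theorem sum_gchoose_succ_mul_natCast (t n : ℕ) (h : t ≤ n) :
    ∑ k ∈ range (n + 1), gchoose ((t : ℚ) + 1) (k + 1) * gchoose (-1 - ((t : ℚ) + 1)) k =
      (-1) ^ t := by
  induction t with
  | zero =>
    rw [sum_range_succ', sum_eq_zero]
    · simp [gchoose_zero, gchoose_succ]
    · intro k _
      have := gchoose_natCast_eq_zero (t := 1) (k := k + 1 + 1) (by omega)
      simp only [Nat.cast_one] at this
      simp [this]
  | succ t ih =>
    have := sum_gchoose_succ_mul_add ((t : ℚ) + 1) n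
    rw [sum_add_distrib, ih (by omega), add_sub_cancel_right,
      gchoose_natCast_eq_zero (show t < n by omega)] at this
    push_cast
    rw [pow_succ]
    linarith

theorem sum_gchooseProd_harm_natCast (t n : ℕ) (h : t ≤ n) :
    ∑ k ∈ range (n + 1), gchooseProd t k * harm k = 2 * (-1) ^ t * harm t := by
  induction t with
  | zero =>
    rw [sum_eq_zero]
    · simp [harm]
    · intro k _
      cases k with
      | zero => simp [harm]
      | succ k => simp [gchooseProd, gchoose_succ_eq_mul_pred]
  | succ t ih =>
    obtain ⟨m, rfl⟩ : ∃ m, n = m + 1 := ⟨n - 1, by omega⟩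
    have h' : (t + 1 : ℚ) ≠ 0 := by positivity
    have key := mul_sum_gchooseProd_harm_add_pred ((t : ℚ) + 1) (m + 1)
    rw [sum_gchoose_succ_mul_natCast t m (by omega), add_sub_cancel_right,
      gchoose_natCast_eq_zero (show t < m + 1 by omega)] at key
    simp only [add_mul, sum_add_distrib] at key
    rw [ih (by omega)] at key
    push_cast
    rw [harm_succ, pow_succ]
    apply mul_left_cancel₀ h'
    field_simp
    linear_combination key

section Padic

variable (p : ℕ) [Fact p.Prime]

/-- The ring of `p`-integral rational numbers. -/
def padicIntegral : Subring ℚ where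
  carrier := {x | padicNorm p x ≤ 1}
  mul_mem' {x y} hx hy := by
    simp only [Set.mem_ofPred_eq, padicNorm.mul] at *
    exact mul_le_one₀ hx (padicNorm.nonneg _) hy
  one_mem' := by simp
  add_mem' {x y} hx hy := padicNorm.nonarchimedean.trans (max_le hx hy)
  zero_mem' := by simp
  neg_mem' {x} hx := by simpa using hx

/-- Congruence modulo `p ^ m` with a `p`-integral quotient. -/
def PadicModEq (m : ℕ) (x y : ℚ) : Prop := ∃ r ∈ padicIntegral p, x = y + p ^ m * r

variable {p} {m : ℕ} {x y z w : ℚ}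

theorem congrMod_iff_padicModEq : CongrMod p m x y ↔ PadicModEq p m x y := by
  have hp : (p : ℚ) ≠ 0 := by exact_mod_cast (Fact.out : p.Prime).ne_zero
  have hpm : (p : ℚ) ^ m ≠ 0 := pow_ne_zero _ hp
  have hp1 : (1 : ℚ) < p := by exact_mod_cast (Fact.out : p.Prime).one_lt
  have norm_le {r : ℚ} (hr : r ≠ 0) : r ∈ padicIntegral p ↔ 0 ≤ padicValRat p r := by
    change padicNorm p r ≤ 1 ↔ _
    rw [padicNorm.eq_zpow_of_nonzero hr, ← zpow_zero (p : ℚ), zpow_le_zpow_iff_right₀ hp1]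
    omega
  have val_pow : padicValRat p ((p : ℚ) ^ m) = m := by
    rw [padicValRat.pow, padicValRat.self (Fact.out : p.Prime).one_lt, mul_one]
  constructor
  · rintro (rfl | h)
    · exact ⟨0, zero_mem _, by simp⟩
    · by_cases hxy : x = y
      · exact ⟨0, zero_mem _, by simp [hxy]⟩
      have hd : x - y ≠ 0 := sub_ne_zero.2 hxy
      refine ⟨(x - y) / p ^ m, ?_, by field_simp; ring⟩
      rw [norm_le (div_ne_zero hd hpm), padicValRat.div hd hpm, val_pow]
      omega
  · rintro ⟨r, hr, rfl⟩
    by_cases h0 : r = 0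
    · left; simp [h0]
    · right
      rw [add_sub_cancel_left, padicValRat.mul hpm h0, val_pow]
      have := (norm_le h0).1 hr
      omega

theorem inv_natCast_mem_padicIntegral {k : ℕ} (h : ¬ p ∣ k) : (1 / k : ℚ) ∈ padicIntegral p := by
  change padicNorm p _ ≤ 1
  rw [padicNorm.div, (padicNorm.nat_eq_one_iff k).2 h]
  simp

theorem inv_succ_mem_padicIntegral {k : ℕ} (h : k + 1 < p) :
    (1 / (k + 1) : ℚ) ∈ padicIntegral p := by
  have := inv_natCast_mem_padicIntegral (p := p) (Nat.not_dvd_of_pos_of_lt k.succ_pos h)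
  simpa using this

theorem mem_padicIntegral_of_not_dvd_den (h : ¬ p ∣ x.den) : x ∈ padicIntegral p := by
  have := mul_mem (intCast_mem (padicIntegral p) x.num) (inv_natCast_mem_padicIntegral h)
  rwa [mul_one_div, Rat.num_div_den] at this

namespace PadicModEq

theorem refl (x : ℚ) : PadicModEq p m x x := ⟨0, zero_mem _, by simp⟩

theorem of_eq (h : x = y) : PadicModEq p m x y := h ▸ refl x

theorem symm (h : PadicModEq p m x y) : PadicModEq p m y x := by
  obtain ⟨r, hr, rfl⟩ := h
  exact ⟨-r, neg_mem hr, by ring⟩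

theorem trans (h : PadicModEq p m x y) (h' : PadicModEq p m y z) : PadicModEq p m x z := by
  obtain ⟨r, hr, rfl⟩ := h
  obtain ⟨s, hs, rfl⟩ := h'
  exact ⟨s + r, add_mem hs hr, by ring⟩

theorem add (h : PadicModEq p m x y) (h' : PadicModEq p m z w) :
    PadicModEq p m (x + z) (y + w) := by
  obtain ⟨r, hr, rfl⟩ := h
  obtain ⟨s, hs, rfl⟩ := h'
  exact ⟨r + s, add_mem hr hs, by ring⟩

theorem neg (h : PadicModEq p m x y) : PadicModEq p m (-x) (-y) := by
  obtain ⟨r, hr, rfl⟩ := h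
  exact ⟨-r, neg_mem hr, by ring⟩

theorem sub (h : PadicModEq p m x y) (h' : PadicModEq p m z w) :
    PadicModEq p m (x - z) (y - w) := by
  simpa only [sub_eq_add_neg] using h.add h'.neg

theorem mul (h : PadicModEq p m x y) (h' : PadicModEq p m z w) (hx : x ∈ padicIntegral p)
    (hw : w ∈ padicIntegral p) : PadicModEq p m (x * z) (y * w) := by
  obtain ⟨r, hr, rfl⟩ := h
  obtain ⟨s, hs, rfl⟩ := h'
  exact ⟨(y + p ^ m * r) * s + w * r, add_mem (mul_mem hx hs) (mul_mem hw hr), by ring⟩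

theorem const_mul (h : PadicModEq p m x y) (hz : z ∈ padicIntegral p) :
    PadicModEq p m (z * x) (z * y) := by
  obtain ⟨r, hr, rfl⟩ := h
  exact ⟨z * r, mul_mem hz hr, by ring⟩

theorem mul_const (h : PadicModEq p m x y) (hz : z ∈ padicIntegral p) :
    PadicModEq p m (x * z) (y * z) := by
  simpa only [mul_comm _ z] using h.const_mul hz

theorem sum {s : Finset ℕ} {f g : ℕ → ℚ} (h : ∀ i ∈ s, PadicModEq p m (f i) (g i)) :
    PadicModEq p m (∑ i ∈ s, f i) (∑ i ∈ s, g i) := by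
  induction s using Finset.cons_induction with
  | empty => simpa using refl 0
  | cons i s hi ih =>
    rw [sum_cons, sum_cons]
    exact (h i (mem_cons_self i s)).add (ih fun j hj => h j (mem_cons_of_mem hj))

theorem mem_iff (h : PadicModEq p m x y) : x ∈ padicIntegral p ↔ y ∈ padicIntegral p := by
  have aux {x y : ℚ} (h : PadicModEq p m x y) (hy : y ∈ padicIntegral p) :
      x ∈ padicIntegral p := by
    obtain ⟨r, hr, rfl⟩ := h
    exact add_mem hy (mul_mem (pow_mem (natCast_mem _ p) m) hr)
  exact ⟨aux h.symm, aux h⟩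

theorem pow (h : PadicModEq p m x y) (hx : x ∈ padicIntegral p) (n : ℕ) :
    PadicModEq p m (x ^ n) (y ^ n) := by
  induction n with
  | zero => simpa using refl 1
  | succ n ih =>
    rw [pow_succ, pow_succ]
    exact ih.mul h (pow_mem hx n) (h.mem_iff.1 hx)

/-- Multiplying by `p` raises the modulus. -/
theorem prime_mul (h : PadicModEq p 1 x y) : PadicModEq p 2 (p * x) (p * y) := by
  obtain ⟨r, hr, rfl⟩ := h
  exact ⟨r, hr, by ring⟩

end PadicModEq

theorem gchoose_mem_padicIntegral (hx : x ∈ padicIntegral p) {k : ℕ} (hk : k < p) :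
    gchoose x k ∈ padicIntegral p := by
  induction k with
  | zero => simp [gchoose_zero, one_mem]
  | succ k ih =>
    rw [gchoose_succ, ← mul_one_div]
    exact mul_mem (mul_mem (ih (by omega)) (sub_mem hx (natCast_mem _ k)))
      (inv_succ_mem_padicIntegral hk)

theorem gchooseProd_mem_padicIntegral (hx : x ∈ padicIntegral p) {k : ℕ} (hk : k < p) :
    gchooseProd x k ∈ padicIntegral p :=
  mul_mem (gchoose_mem_padicIntegral hx hk)
    (gchoose_mem_padicIntegral (sub_mem (neg_mem (one_mem _)) hx) hk)

theorem harm_mem_padicIntegral {k : ℕ} (hk : k < p) : harm k ∈ padicIntegral p :=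
  sum_mem fun j hj => inv_succ_mem_padicIntegral (by have := mem_range.1 hj; omega)

theorem gchoose_padicModEq (h : PadicModEq p m x y) (hx : x ∈ padicIntegral p) {k : ℕ}
    (hk : k < p) : PadicModEq p m (gchoose x k) (gchoose y k) := by
  induction k with
  | zero => simpa [gchoose_zero] using PadicModEq.refl 1
  | succ k ih =>
    have hy := h.mem_iff.1 hx
    rw [gchoose_succ, gchoose_succ, ← mul_one_div, ← mul_one_div (_ * (y - _))]
    exact ((ih (by omega)).mul (h.sub (.refl _)) (gchoose_mem_padicIntegral hx (by omega))
      (sub_mem hy (natCast_mem _ k))).mul_const (inv_succ_mem_padicIntegral hk)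

theorem gchooseProd_padicModEq (h : PadicModEq p m x y) (hx : x ∈ padicIntegral p) {k : ℕ}
    (hk : k < p) : PadicModEq p m (gchooseProd x k) (gchooseProd y k) := by
  have hm : (-1 : ℚ) ∈ padicIntegral p := neg_mem (one_mem _)
  exact (gchoose_padicModEq h hx hk).mul
    (gchoose_padicModEq ((PadicModEq.refl _).sub h) (sub_mem hm hx) hk)
    (gchoose_mem_padicIntegral hx hk)
    (gchoose_mem_padicIntegral (sub_mem hm (h.mem_iff.1 hx)) hk)

theorem gchoose_padicModEq_zero {t k : ℕ} (h : PadicModEq p 1 x t) (hk : k < p) (ht : t < k) :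
    PadicModEq p 1 (gchoose x k) 0 := by
  have := gchoose_padicModEq h (h.mem_iff.2 (natCast_mem _ t)) hk
  rwa [gchoose_natCast_eq_zero ht] at this

theorem choose_mul_neg_one_pow_padicModEq {k : ℕ} (hk : k < p) :
    PadicModEq p 2 ((Nat.choose (p - 1) k : ℚ) * (-1) ^ k) (1 - p * harm k) := by
  induction k with
  | zero => simpa [harm] using PadicModEq.refl 1
  | succ k ih =>
    have h' : (k + 1 : ℚ) ≠ 0 := by positivity
    have hs : (Nat.choose (p - 1) (k + 1) : ℚ) * (k + 1) =
        Nat.choose (p - 1) k * (p - 1 - k) := by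
      have := Nat.choose_succ_right_eq (p - 1) k
      have e : ((p - 1 - k : ℕ) : ℚ) = p - 1 - k := by
        rw [Nat.cast_sub (by omega), Nat.cast_sub (by omega), Nat.cast_one]
      rw [← e]
      exact_mod_cast this
    have hi := inv_succ_mem_padicIntegral hk
    have e : (Nat.choose (p - 1) (k + 1) : ℚ) * (-1) ^ (k + 1) =
        Nat.choose (p - 1) k * (-1) ^ k * (1 - p * (1 / (k + 1))) := by
      rw [pow_succ]
      field_simp
      linear_combination -hs
    rw [e]
    refine ((ih (by omega)).mul_const
      (sub_mem (one_mem _) (mul_mem (natCast_mem _ p) hi))).trans ?_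
    refine ⟨harm k * (1 / (k + 1)), mul_mem (harm_mem_padicIntegral (by omega)) hi, ?_⟩
    rw [harm_succ]
    ring

theorem harm_prime_sub_one_padicModEq_zero (hp : 2 < p) : PadicModEq p 1 (harm (p - 1)) 0 := by
  have h2 : (1 / 2 : ℚ) ∈ padicIntegral p := by
    have := inv_succ_mem_padicIntegral (p := p) (k := 1) (by omega)
    norm_num at this ⊢
    exact this
  refine ⟨1 / 2 * ∑ j ∈ range (p - 1), 1 / (j + 1 : ℚ) * (1 / ((p - 1 - 1 - j : ℕ) + 1 : ℚ)),
    mul_mem h2 (sum_mem fun j hj => ?_), ?_⟩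
  · have := mem_range.1 hj
    exact mul_mem (inv_succ_mem_padicIntegral (by omega)) (inv_succ_mem_padicIntegral (by omega))
  · have h := sum_range_reflect (fun j : ℕ => (1 : ℚ) / (j + 1)) (p - 1)
    have : harm (p - 1) + harm (p - 1) =
        p * ∑ j ∈ range (p - 1), 1 / (j + 1 : ℚ) * (1 / ((p - 1 - 1 - j : ℕ) + 1 : ℚ)) := by
      conv_lhs => enter [2]; rw [harm, ← h]
      rw [harm, ← sum_add_distrib, mul_sum]
      refine sum_congr rfl fun j hj => ?_
      have hj := mem_range.1 hj
      have e : ((p - 1 - 1 - j : ℕ) : ℚ) + 1 = p - (j + 1) := by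
        have : p - 1 - 1 - j + 1 + (j + 1) = p := by omega
        rw [eq_sub_iff_add_eq]
        exact_mod_cast this
      have h1 : (j + 1 : ℚ) ≠ 0 := by positivity
      have h2 : (p - (j + 1) : ℚ) ≠ 0 := by rw [← e]; positivity
      rw [e]
      field_simp
      ring
    linear_combination this / 2

theorem sum_gchooseProd_padicModEq (hp : 2 < p) {t : ℕ} (ht : t < p) (h : PadicModEq p 1 x t) :
    PadicModEq p 2 (∑ k ∈ range p, gchooseProd x k) ((-1) ^ t) := by
  have hpp : p = p - 1 + 1 := by omega
  have hm : (-1 : ℚ) ∈ padicIntegral p := neg_mem (one_mem _)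
  induction t generalizing x with
  | zero =>
    obtain ⟨y, hy, hx⟩ := h
    have hx : x = p * y := by simpa using hx
    have hxm : x ∈ padicIntegral p := hx ▸ mul_mem (natCast_mem _ p) hy
    have hx0 : PadicModEq p 1 x 0 := ⟨y, hy, by simp [hx]⟩
    rw [congrArg range hpp, sum_range_succ', gchooseProd_zero]
    have hterm : PadicModEq p 2 (∑ k ∈ range (p - 1), gchooseProd x (k + 1))
        (∑ k ∈ range (p - 1), p * (y * (-1 * (1 / (k + 1 : ℚ))))) := by
      refine PadicModEq.sum fun k hk => ?_
      have hk := mem_range.1 hk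
      have hi := inv_succ_mem_padicIntegral (p := p) (k := k) (by omega)
      have h1 := gchoose_padicModEq (hx0.sub (.refl 1)) (sub_mem hxm (one_mem _))
        (show k < p by omega)
      have h2 := gchoose_padicModEq ((PadicModEq.refl (-1)).sub hx0) (sub_mem hm hxm)
        (show k + 1 < p by omega)
      rw [zero_sub, gchoose_neg_one] at h1
      rw [sub_zero, gchoose_neg_one] at h2
      have h3 := h1.mul h2 (gchoose_mem_padicIntegral (sub_mem hxm (one_mem _)) (by omega))
        (pow_mem hm _)
      have e : (-1 : ℚ) ^ k * (-1) ^ (k + 1) = -1 := by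
        rw [← pow_add, show k + (k + 1) = 2 * k + 1 by ring, pow_succ, pow_mul]
        simp
      rw [e] at h3
      convert ((h3.mul_const hi).const_mul hy).prime_mul using 1
      rw [gchooseProd, gchoose_succ_eq_mul_pred x, hx]
      ring
    have hsum : PadicModEq p 2 (∑ k ∈ range (p - 1), p * (y * (-1 * (1 / (k + 1 : ℚ))))) 0 := by
      rw [← mul_sum, ← mul_sum, ← mul_sum]
      have := ((harm_prime_sub_one_padicModEq_zero hp).const_mul hm).const_mul hy
      simpa [harm] using this.prime_mul
    simpa using (hterm.trans hsum).add (.refl 1)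
  | succ t ih =>
    have hx : x ∈ padicIntegral p := h.mem_iff.2 (natCast_mem _ _)
    have hx1 : PadicModEq p 1 (x - 1) t := by
      simpa using h.sub (.refl 1)
    have key := sum_gchooseProd_add_pred x (p - 1)
    rw [← hpp, sum_add_distrib] at key
    have hx2 : PadicModEq p 1 (-1 - x) ((p - 2 - t : ℕ) : ℚ) := by
      refine ((PadicModEq.refl (-1)).sub h).trans ⟨-1, hm, ?_⟩
      rw [Nat.cast_sub (by omega), Nat.cast_sub (by omega)]
      push_cast
      ring
    obtain ⟨r, hr, hr'⟩ := gchoose_padicModEq_zero hx1 (show p - 1 < p by omega) (by omega)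
    obtain ⟨s, hs, hs'⟩ := gchoose_padicModEq_zero hx2 (show p - 1 < p by omega) (by omega)
    rw [hr', hs'] at key
    have hsum : PadicModEq p 2 (∑ k ∈ range p, gchooseProd x k)
        (-∑ k ∈ range p, gchooseProd (x - 1) k) :=
      ⟨2 * (r * s), mul_mem (ofNat_mem _ 2) (mul_mem hr hs), by linear_combination key⟩
    have := hsum.trans (ih (by omega) hx1).neg
    rwa [← neg_one_mul, ← pow_succ'] at this

theorem sum_gchooseProd_harm_padicModEq {t : ℕ} (ht : t < p) (h : PadicModEq p 1 x t) :
    PadicModEq p 1 (∑ k ∈ range p, gchooseProd x k * harm k) (2 * (-1) ^ t * harm t) := by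
  have hpp : p = p - 1 + 1 := by omega
  have := sum_gchooseProd_harm_natCast t (p - 1) (by omega)
  rw [← hpp] at this
  rw [← this]
  refine PadicModEq.sum fun k hk => ?_
  have hk := mem_range.1 hk
  exact (gchooseProd_padicModEq h (h.mem_iff.2 (natCast_mem _ _)) hk).mul_const
    (harm_mem_padicIntegral hk)

theorem bernoulli_mem_padicIntegral {n : ℕ} (h : n + 1 < p) : bernoulli n ∈ padicIntegral p := by
  induction n using Nat.strong_induction_on with
  | _ n ih =>
    have hs := sum_bernoulli (n + 1)
    rw [sum_range_succ, Nat.choose_succ_self_right] at hs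
    have h' : (n + 1 : ℚ) ≠ 0 := by positivity
    have e : bernoulli n = ((if n + 1 = 1 then 1 else 0) -
        ∑ k ∈ range n, ((n + 1).choose k : ℚ) * bernoulli k) * (1 / (n + 1)) := by
      rw [← hs]
      push_cast
      field_simp
      ring
    rw [e]
    refine mul_mem (sub_mem (by split_ifs <;> simp [one_mem]) (sum_mem fun k hk => ?_))
      (inv_succ_mem_padicIntegral h)
    have hk := mem_range.1 hk
    exact mul_mem (natCast_mem _ _) (ih k hk (by omega))

theorem natCast_pow_prime_sub_two_padicModEq (hp : 2 < p) {t : ℕ} (ht : t + 1 < p) :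
    PadicModEq p 1 ((t + 1 : ℚ) ^ (p - 2)) (1 / (t + 1)) := by
  have hne : ((t + 1 : ℕ) : ZMod p) ≠ 0 := by
    rw [Ne, ZMod.natCast_eq_zero_iff]
    exact Nat.not_dvd_of_pos_of_lt t.succ_pos ht
  have hf := ZMod.pow_card_sub_one_eq_one hne
  have hd : (p : ℤ) ∣ ((t + 1 : ℕ) : ℤ) ^ (p - 1) - 1 := by
    rw [← ZMod.intCast_zmod_eq_zero_iff_dvd]
    push_cast at hf ⊢
    rw [hf, sub_self]
  obtain ⟨c, hc⟩ := hd
  have hc : (t + 1 : ℚ) ^ (p - 1) - 1 = p * c := by exact_mod_cast hc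
  have h' : (t + 1 : ℚ) ≠ 0 := by positivity
  refine ⟨c * (1 / (t + 1)), mul_mem (intCast_mem _ c) (inv_succ_mem_padicIntegral ht), ?_⟩
  rw [show p - 1 = p - 2 + 1 by omega, pow_succ] at hc
  field_simp
  linear_combination hc

theorem bpoly_neg_sub_bernoulli_padicModEq (hp : 2 < p) {t : ℕ} (ht : t < p)
    (h : PadicModEq p 1 x t) :
    PadicModEq p 1 (bpoly (p - 1) (-x) - bernoulli (p - 1)) (-harm t) := by
  induction t generalizing x with
  | zero =>
    obtain ⟨y, hy, hx⟩ := h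
    have hx : x = p * y := by simpa using hx
    have hxm : x ∈ padicIntegral p := hx ▸ mul_mem (natCast_mem _ p) hy
    rw [bpoly, Polynomial.bernoulli_def, Polynomial.eval_finsetSum, sum_range_succ']
    simp only [Polynomial.eval_monomial]
    refine ⟨∑ k ∈ range (p - 1), bernoulli (p - 1 - (k + 1)) * ((p - 1).choose (k + 1) : ℚ) *
      ((-x) ^ k * -y), sum_mem fun k hk => ?_, ?_⟩
    · have hk := mem_range.1 hk
      exact mul_mem (mul_mem (bernoulli_mem_padicIntegral (by omega)) (natCast_mem _ _))
        (mul_mem (pow_mem (neg_mem hxm) k) (neg_mem hy))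
    · simp only [harm, range_zero, sum_empty, mul_sum]
      simp only [Nat.sub_zero, Nat.choose_zero_right, Nat.cast_one, pow_zero, mul_one,
        add_sub_cancel_right, neg_zero, zero_add]
      refine sum_congr rfl fun k _ => ?_
      rw [pow_succ]
      nth_rewrite 2 [hx]
      ring
  | succ t ih =>
    have hx : x ∈ padicIntegral p := h.mem_iff.2 (natCast_mem _ _)
    have hx1 : PadicModEq p 1 (x - 1) t := by
      simpa using h.sub (.refl 1)
    have hstep := Polynomial.bernoulli_eval_one_add (p - 1) (-x)
    rw [show 1 + -x = -(x - 1) by ring, show p - 1 - 1 = p - 2 by omega,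
      Nat.cast_sub (by omega), Nat.cast_one,
      Odd.neg_pow (Nat.Odd.sub_even (by omega)
        ((Fact.out : p.Prime).odd_of_ne_two (by omega)) even_two)] at hstep
    have hpow := h.pow hx (p - 2)
    push_cast at hpow
    have hpow := hpow.trans (natCast_pow_prime_sub_two_padicModEq hp ht)
    have hi := inv_succ_mem_padicIntegral ht
    have hc : PadicModEq p 1 ((p : ℚ) - 1) (-1) := ⟨1, one_mem _, by ring⟩
    have hmul := hc.mul hpow (sub_mem (natCast_mem _ p) (one_mem _)) hi
    have := (ih (by omega) hx1).add hmul
    simp only [bpoly] at this ⊢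
    rw [harm_succ]
    convert this using 1
    · rw [hstep]; ring
    · ring

end Padic

theorem stmt_4 (p : ℕ) (hp : p.Prime) (hp3 : 3 < p) (a : ℚ) (ha : ¬ (p ∣ a.den))
    (t : ℕ) (ht : t < p) (hat : CongrMod p 1 (-a) t) :
    CongrMod p 2
      (∑ k ∈ Finset.range p,
        (Nat.choose (p - 1) k : ℚ) * gchoose (-a) k * gchoose (a - 1) k * (-1) ^ k)
      ((-1 : ℚ) ^ t * (1 + 2 * p * (bpoly (p - 1) a - bernoulli (p - 1)))) := by
  have : Fact p.Prime := ⟨hp⟩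
  rw [congrMod_iff_padicModEq] at hat ⊢
  have hm : (-a) ∈ padicIntegral p := neg_mem (mem_padicIntegral_of_not_dvd_den ha)
  have hsplit : PadicModEq p 2
      (∑ k ∈ Finset.range p,
        (Nat.choose (p - 1) k : ℚ) * gchoose (-a) k * gchoose (a - 1) k * (-1) ^ k)
      (∑ k ∈ range p, (1 - p * harm k) * gchooseProd (-a) k) := by
    refine PadicModEq.sum fun k hk => ?_
    have hk := mem_range.1 hk
    convert (choose_mul_neg_one_pow_padicModEq hk).mul_const
      (gchooseProd_mem_padicIntegral hm hk) using 1
    rw [gchooseProd, show -1 - -a = a - 1 by ring]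
    ring
  have hS := sum_gchooseProd_padicModEq (by omega) ht hat
  have hT := (sum_gchooseProd_harm_padicModEq ht hat).prime_mul
  have hB := bpoly_neg_sub_bernoulli_padicModEq (by omega) ht hat
  rw [neg_neg] at hB
  have hone : (-1 : ℚ) ^ t ∈ padicIntegral p := pow_mem (neg_mem (one_mem _)) t
  have hB' := ((hB.const_mul (mul_mem (ofNat_mem (padicIntegral p) 2) hone)).prime_mul).symm
  have := hsplit.trans ((PadicModEq.of_eq ?_).trans ((hS.sub hT).trans
    ((PadicModEq.of_eq ?_).trans ((PadicModEq.refl ((-1) ^ t)).add hB'))))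
  · convert this using 1
    ring
  · rw [mul_sum, ← sum_sub_distrib]
    exact sum_congr rfl fun k _ => by ring
  · ring
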